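/- Let A ∈ ℝ^{I×R} and B ∈ ℝ^{J×R} have positive definite Gram matrices AᵀA and BᵀB (so that the Gram matrix of A⊙B, which equals (AᵀA) ⊛ (BᵀB), is also positive definite). Then for every pair (i,j) ∈ [I]×[J], the leverage score of row (i,j) of the Khatri-Rao product is bounded by the product of the factor leverage scores: ℓ_{(i,j)}(A⊙B) ≤ ℓ_i(A)·ℓ_j(B). -/

import Mathlib

open Matrix BigOperators

/-- The Khatri-Rao product of `A ∈ ℝ^{I×R}` and `B ∈ ℝ^{J×R}`: the matrix with
rows indexed by pairs `(i,j)` defined by `(A⊙B)[(i,j), r] = A[i,r] · B[j,r]`. -/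
def kr2 {I J R : ℕ} (A : Matrix (Fin I) (Fin R) ℝ) (B : Matrix (Fin J) (Fin R) ℝ) :
    Matrix (Fin I × Fin J) (Fin R) ℝ :=
  Matrix.of fun p r => A p.1 r * B p.2 r

/-- The leverage score of row `x` of a matrix `M`:
`ℓ_x(M) = M[x,:] · (MᵀM)⁻¹ · M[x,:]ᵀ`. -/
noncomputable def levScore {n R : Type*} [Fintype n] [Fintype R] [DecidableEq R]
    (M : Matrix n R ℝ) (x : n) : ℝ :=
  M x ⬝ᵥ (Mᵀ * M)⁻¹ *ᵥ M x

/-- A rank one matrix `v vᵀ` is dominated by `(vᵀ P⁻¹ v) P` for positive definite `P`. -/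
theorem Matrix.PosDef.posSemidef_smul_sub_vecMulVec {n : Type*} [Fintype n] [DecidableEq n]
    {P : Matrix n n ℝ} (hP : P.PosDef) (v : n → ℝ) :
    ((v ⬝ᵥ P⁻¹ *ᵥ v) • P - vecMulVec v v).PosSemidef := by
  have hsymm : Pᵀ = P := by simpa using hP.isHermitian.eq
  refine PosSemidef.of_dotProduct_mulVec_nonneg ?_ fun x => ?_
  · ext i j
    simpa [vecMulVec_apply, mul_comm (v j)] using Or.inl (congrFun₂ hsymm i j)
  · set w := P⁻¹ *ᵥ v with hw
    have hPw : P *ᵥ w = v := by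
      rw [hw, mulVec_mulVec, mul_nonsing_inv _ ((isUnit_iff_isUnit_det P).1 hP.isUnit),
        one_mulVec]
    have hwP : w ⬝ᵥ P *ᵥ x = v ⬝ᵥ x := by
      rw [dotProduct_mulVec, ← mulVec_transpose, hsymm, hPw]
    have hquad : ∀ r : ℝ, 0 ≤ (v ⬝ᵥ w) * (r * r) + (-2 * (v ⬝ᵥ x)) * r + x ⬝ᵥ P *ᵥ x := by
      intro r
      have h := hP.posSemidef.dotProduct_mulVec_nonneg (x - r • w)
      simp only [star_trivial, mulVec_sub, mulVec_smul, hPw, sub_dotProduct, dotProduct_sub,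
        smul_dotProduct, dotProduct_smul, smul_eq_mul, hwP, dotProduct_comm x v,
        dotProduct_comm w v] at h
      linarith
    have hdisc := discrim_le_zero hquad
    simp only [discrim] at hdisc
    simp only [star_trivial, sub_mulVec, smul_mulVec, vecMulVec_mulVec, dotProduct_sub,
      dotProduct_smul, smul_eq_mul, op_smul_eq_smul, dotProduct_comm x v]
    nlinarith

/-- If `v vᵀ ≤ t P` in the Loewner order, with `P` positive definite and `t ≥ 0`, then
`vᵀ P⁻¹ v ≤ t`. -/
theorem Matrix.PosDef.dotProduct_inv_mulVec_le {n : Type*} [Fintype n] [DecidableEq n]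
    {P : Matrix n n ℝ} (hP : P.PosDef) {v : n → ℝ} {t : ℝ} (ht : 0 ≤ t)
    (h : (t • P - vecMulVec v v).PosSemidef) : v ⬝ᵥ P⁻¹ *ᵥ v ≤ t := by
  set w := P⁻¹ *ᵥ v with hw
  have hPw : P *ᵥ w = v := by
    rw [hw, mulVec_mulVec, mul_nonsing_inv _ ((isUnit_iff_isUnit_det P).1 hP.isUnit),
      one_mulVec]
  have hnonneg := h.dotProduct_mulVec_nonneg w
  simp only [star_trivial, sub_mulVec, smul_mulVec, vecMulVec_mulVec, dotProduct_sub,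
    dotProduct_smul, smul_eq_mul, op_smul_eq_smul, hPw, dotProduct_comm w v] at hnonneg
  by_contra! hlt
  nlinarith

/-- The Gram matrix of a Khatri-Rao product is the Hadamard product of the Gram matrices. -/
theorem transpose_kr2_mul_kr2 {I J R : ℕ} (A : Matrix (Fin I) (Fin R) ℝ)
    (B : Matrix (Fin J) (Fin R) ℝ) :
    (kr2 A B)ᵀ * kr2 A B = (Aᵀ * A) ⊙ (Bᵀ * B) := by
  ext r s
  simp only [mul_apply, transpose_apply, hadamard_apply, kr2, of_apply, Fintype.sum_prod_type,
    Finset.sum_mul_sum]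
  exact Finset.sum_congr rfl fun i _ => Finset.sum_congr rfl fun j _ => by ring

/-- Leverage scores are nonnegative when the Gram matrix is positive definite. -/
theorem levScore_nonneg {n R : Type*} [Fintype n] [Fintype R] [DecidableEq R]
    {M : Matrix n R ℝ} (hM : (Mᵀ * M).PosDef) (x : n) : 0 ≤ levScore M x := by
  simpa [levScore] using hM.inv.posSemidef.dotProduct_mulVec_nonneg (M x)

/-- If `AᵀA` and `BᵀB` are positive definite, then the leverage score of each
row `(i,j)` of the Khatri-Rao product is bounded by the product of the factor
leverage scores: `ℓ_{(i,j)}(A⊙B) ≤ ℓ_i(A) · ℓ_j(B)`. -/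
theorem stmt5 {I J R : ℕ} (A : Matrix (Fin I) (Fin R) ℝ) (B : Matrix (Fin J) (Fin R) ℝ)
    (hA : (Aᵀ * A).PosDef) (hB : (Bᵀ * B).PosDef) :
    ∀ (i : Fin I) (j : Fin J),
      levScore (kr2 A B) (i, j) ≤ levScore A i * levScore B j := by
  intro i j
  have hAi := hA.posSemidef_smul_sub_vecMulVec (A i)
  have hBj := hB.posSemidef_smul_sub_vecMulVec (B j)
  have hK : ((kr2 A B)ᵀ * kr2 A B).PosDef := by
    rw [transpose_kr2_mul_kr2]
    exact hA.hadamard hB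
  refine hK.dotProduct_inv_mulVec_le
    (mul_nonneg (levScore_nonneg hA i) (levScore_nonneg hB j)) ?_
  have hb : (vecMulVec (B j) (B j)).PosSemidef := by
    simpa using posSemidef_vecMulVec_self_star (B j)
  have hdecomp : (levScore A i * levScore B j) • ((kr2 A B)ᵀ * kr2 A B) -
        vecMulVec (kr2 A B (i, j)) (kr2 A B (i, j)) =
      (levScore A i • (Aᵀ * A)) ⊙ (levScore B j • (Bᵀ * B) - vecMulVec (B j) (B j)) +
        (levScore A i • (Aᵀ * A) - vecMulVec (A i) (A i)) ⊙ vecMulVec (B j) (B j) := by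
    rw [transpose_kr2_mul_kr2]
    ext r s
    simp only [kr2, Matrix.sub_apply, Matrix.add_apply, Matrix.smul_apply, hadamard_apply,
      vecMulVec_apply, of_apply, smul_eq_mul]
    ring
  rw [hdecomp]
  exact ((hA.posSemidef.smul (levScore_nonneg hA i)).hadamard hBj).add (hAi.hadamard hb)
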